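/- With the spherical Hankel functions h₀, h₁, h₂ and impedances Z_M, Z_L, Z_T as defined: for all a > 0 and ω > 0, h₁(ka)/(ka · h₀(ka)) = −Z_L/(3 Z_M) and h₂(ka)/h₀(ka) = −(Z_L + Z_M)/Z_M; moreover the same two identities hold with k replaced by h and Z_L replaced by Z_T throughout, i.e. h₁(ha)/(ha · h₀(ha)) = −Z_T/(3 Z_M) and h₂(ha)/h₀(ha) = −(Z_T + Z_M)/Z_M. -/

import Mathlib

open Complex

lemma hankel_aux (a ρ M ω c k : ℝ) (ha : 0 < a) (hρ : 0 < ρ) (hM : 0 < M) (hω : 0 < ω)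
    (hc : c = Real.sqrt (M / ρ)) (hk : k = ω / c)
    (sh0 sh1 sh2 : ℂ → ℂ)
    (hsh0 : ∀ z : ℂ, sh0 z = Complex.exp (I * z) / (I * z))
    (hsh1 : ∀ z : ℂ, sh1 z = -Complex.exp (I * z) * (z + I) / z ^ 2)
    (hsh2 : ∀ z : ℂ, sh2 z = -sh0 z + (3 / z) * sh1 z)
    (ZM ZL : ℂ)
    (hZM : ZM = I * ω * (4 / 3) * Real.pi * a ^ 3 * ρ)
    (hZL : ZL = (I * ω)⁻¹ * (4 * Real.pi * a * M) * (1 - I * k * a)) :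
    sh1 ((k * a : ℝ)) / (((k * a : ℝ)) * sh0 ((k * a : ℝ))) = -ZL / (3 * ZM) ∧
    sh2 ((k * a : ℝ)) / sh0 ((k * a : ℝ)) = -(ZL + ZM) / ZM := by
  have hc0 : 0 < c := by rw [hc]; positivity
  have hc2 : c ^ 2 = M / ρ := by rw [hc, Real.sq_sqrt (by positivity)]
  have hk0 : 0 < k := by rw [hk]; positivity
  have hkM : M * k ^ 2 = ω ^ 2 * ρ := by
    rw [hk, div_pow, hc2]; field_simp
  have hkM' : (M : ℂ) * k ^ 2 = ω ^ 2 * ρ := by exact_mod_cast hkM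
  have hkC : (k : ℂ) ≠ 0 := by exact_mod_cast hk0.ne'
  have haC : (a : ℂ) ≠ 0 := by exact_mod_cast ha.ne'
  have hρC : (ρ : ℂ) ≠ 0 := by exact_mod_cast hρ.ne'
  have hωC : (ω : ℂ) ≠ 0 := by exact_mod_cast hω.ne'
  have hπC : (Real.pi : ℂ) ≠ 0 := by exact_mod_cast Real.pi_ne_zero
  have hZM0 : ZM ≠ 0 := by
    rw [hZM]; simp [hωC, hπC, haC, hρC]
  have hz : ((k * a : ℝ) : ℂ) ≠ 0 := by exact_mod_cast (mul_pos hk0 ha).ne'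
  have hs0 : sh0 ((k * a : ℝ)) ≠ 0 := by
    rw [hsh0]; exact div_ne_zero (Complex.exp_ne_zero _) (mul_ne_zero I_ne_zero hz)
  have key1 : sh1 ((k * a : ℝ)) / (((k * a : ℝ)) * sh0 ((k * a : ℝ)))
      = (1 - I * ((k * a : ℝ) : ℂ)) / ((k * a : ℝ) : ℂ) ^ 2 := by
    rw [hsh0, hsh1]
    generalize ((k * a : ℝ) : ℂ) = z at hz
    have he := Complex.exp_ne_zero (I * z)
    have hI := I_ne_zero
    generalize Complex.exp (I * z) = e at he
    field_simp
    linear_combination -I_sq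
  have key2 : -ZL / (3 * ZM) = (1 - I * ((k * a : ℝ) : ℂ)) / ((k * a : ℝ) : ℂ) ^ 2 := by
    rw [div_eq_div_iff (mul_ne_zero (by norm_num) hZM0) (pow_ne_zero 2 hz), hZM, hZL, mul_inv, inv_I]
    push_cast
    field_simp
    linear_combination (1 - I * k * a) * hkM'
  have h1 := key1.trans key2.symm
  refine ⟨h1, ?_⟩
  have h2 : sh2 ((k * a : ℝ)) / sh0 ((k * a : ℝ))
      = -1 + 3 * (sh1 ((k * a : ℝ)) / (((k * a : ℝ)) * sh0 ((k * a : ℝ)))) := by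
    rw [hsh2]; field_simp
  rw [h2, h1]
  field_simp
  ring

/-- Identities relating spherical Hankel functions evaluated at `ka` (resp. `ha`)
to the lumped impedances `Z_M`, `Z_L` (resp. `Z_T`): Eq. (B4) of the paper. -/
theorem hankel_impedance_identities (a ρ lam mu ω : ℝ)
    (ha : 0 < a) (hρ : 0 < ρ) (hmu : 0 < mu) (hlam : 0 < lam + 2 * mu) (hω : 0 < ω)
    (cL cT k h : ℝ)
    (hcL : cL = Real.sqrt ((lam + 2 * mu) / ρ)) (hcT : cT = Real.sqrt (mu / ρ))
    (hk : k = ω / cL) (hh : h = ω / cT)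
    (sh0 sh1 sh2 : ℂ → ℂ)
    (hsh0 : ∀ z : ℂ, sh0 z = Complex.exp (I * z) / (I * z))
    (hsh1 : ∀ z : ℂ, sh1 z = -Complex.exp (I * z) * (z + I) / z ^ 2)
    (hsh2 : ∀ z : ℂ, sh2 z = -sh0 z + (3 / z) * sh1 z)
    (ZM ZL ZT : ℂ)
    (hZM : ZM = I * ω * (4 / 3) * Real.pi * a ^ 3 * ρ)
    (hZL : ZL = (I * ω)⁻¹ * (4 * Real.pi * a * (lam + 2 * mu)) * (1 - I * k * a))
    (hZT : ZT = (I * ω)⁻¹ * (4 * Real.pi * a * mu) * (1 - I * h * a)) :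
    sh1 ((k * a : ℝ)) / (((k * a : ℝ)) * sh0 ((k * a : ℝ))) = -ZL / (3 * ZM) ∧
    sh2 ((k * a : ℝ)) / sh0 ((k * a : ℝ)) = -(ZL + ZM) / ZM ∧
    sh1 ((h * a : ℝ)) / (((h * a : ℝ)) * sh0 ((h * a : ℝ))) = -ZT / (3 * ZM) ∧
    sh2 ((h * a : ℝ)) / sh0 ((h * a : ℝ)) = -(ZT + ZM) / ZM := by
  have hL := hankel_aux a ρ (lam + 2 * mu) ω cL k ha hρ hlam hω hcL hk sh0 sh1 sh2 hsh0 hsh1 hsh2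
    ZM ZL hZM (by rw [hZL]; push_cast; rfl)
  have hT := hankel_aux a ρ mu ω cT h ha hρ hmu hω hcT hh sh0 sh1 sh2 hsh0 hsh1 hsh2
    ZM ZT hZM hZT
  exact ⟨hL.1, hL.2, hT.1, hT.2⟩
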